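/- (Lemma 1 of the paper.) Let A, B, C, D be four points in the Euclidean plane forming a convex quadrilateral, i.e., there exists a point P lying both on the segment from A to C and on the segment from B to D. If all four sides are longer than the shorter diagonal, i.e., min(dist(A,C), dist(B,D)) < dist(A,B), min(dist(A,C), dist(B,D)) < dist(B,C), min(dist(A,C), dist(B,D)) < dist(C,D), and min(dist(A,C), dist(B,D)) < dist(D,A), then the longer diagonal is longer than every side: max(dist(A,C), dist(B,D)) > dist(A,B), max(dist(A,C), dist(B,D)) > dist(B,C), max(dist(A,C), dist(B,D)) > dist(C,D), and max(dist(A,C), dist(B,D)) > dist(D,A). -/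

import Mathlib

/-- If the diagonals of a quadrilateral meet, the sum of either pair of opposite sides is at most
the sum of the diagonals. -/
theorem dist_add_dist_le_of_mem_segment {E : Type*} [SeminormedAddCommGroup E] [NormedSpace ℝ E]
    {A B C D P : E} (hAC : P ∈ segment ℝ A C) (hBD : P ∈ segment ℝ B D) :
    dist A B + dist C D ≤ dist A C + dist B D ∧ dist B C + dist D A ≤ dist A C + dist B D := by
  have h₁ := dist_add_dist_of_mem_segment hAC
  have h₂ := dist_add_dist_of_mem_segment hBD
  have h₃ := dist_triangle A P B
  have h₄ := dist_triangle_left C D P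
  have h₅ := dist_triangle B P C
  have h₆ := dist_triangle_right D A P
  rw [dist_comm P B] at h₃
  rw [dist_comm D P] at h₆
  constructor <;> linarith

/-- Lemma 1 of the paper: in any convex quadrilateral (diagonals intersect)
with all four sides longer than the shorter diagonal, the longer diagonal is
longer than every side. -/
theorem longest_diagonal_longer_than_sides
    (A B C D : EuclideanSpace ℝ (Fin 2))
    (h : ∃ P, P ∈ segment ℝ A C ∩ segment ℝ B D)
    (hAB : min (dist A C) (dist B D) < dist A B)
    (hBC : min (dist A C) (dist B D) < dist B C)
    (hCD : min (dist A C) (dist B D) < dist C D)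
    (hDA : min (dist A C) (dist B D) < dist D A) :
    max (dist A C) (dist B D) > dist A B ∧
    max (dist A C) (dist B D) > dist B C ∧
    max (dist A C) (dist B D) > dist C D ∧
    max (dist A C) (dist B D) > dist D A := by
  obtain ⟨P, hAC, hBD⟩ := h
  obtain ⟨h₁, h₂⟩ := dist_add_dist_le_of_mem_segment hAC hBD
  have h₃ := min_add_max (dist A C) (dist B D)
  refine ⟨?_, ?_, ?_, ?_⟩ <;> linarith
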